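/- Let n ≥ 1 and let Q₁,…,Qₙ be pairwise distinct smooth conics in ℙ² such that: (i) for each 2 ≤ i ≤ n there is a point pᵢ with Q₁ ∩ Qᵢ = {pᵢ}; (ii) for all 2 ≤ i < j ≤ n the intersection Qᵢ ∩ Qⱼ consists of exactly four points; and (iii) no point of ℙ² lies on three of the conics. If n = 1, then π₁(ℙ² ∖ (Q₁ ∪ ⋯ ∪ Qₙ)) is abelian; if n ≥ 2, then this group is big. -/

import Mathlib

open MvPolynomial

noncomputable section

/-- The complex projective plane, with the quotient topology. -/
instance : TopologicalSpace (Projectivization ℂ (Fin 3 → ℂ)) :=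
  @instTopologicalSpaceQuotient _ (projectivizationSetoid ℂ (Fin 3 → ℂ)) _

abbrev P2 : Type := Projectivization ℂ (Fin 3 → ℂ)

/-- The gradient of a polynomial in three variables. -/
def gradP (P : MvPolynomial (Fin 3) ℂ) (v : Fin 3 → ℂ) : Fin 3 → ℂ :=
  fun i => eval v (pderiv i P)

/-- The zero locus in `ℙ²` of a (homogeneous) polynomial in three variables. -/
def zeroLocusP2 (P : MvPolynomial (Fin 3) ℂ) : Set P2 :=
  {x | eval x.rep P = 0}

/-- A smooth conic: the zero locus of a homogeneous polynomial of degree 2 whose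
gradient vanishes only at the origin. -/
def IsSmoothConic (Q : Set P2) : Prop :=
  ∃ P : MvPolynomial (Fin 3) ℂ, P.IsHomogeneous 2 ∧
    (∀ v : Fin 3 → ℂ, v ≠ 0 → gradP P v ≠ 0) ∧ Q = zeroLocusP2 P

/-- A group is big if it contains a non-abelian free subgroup. -/
def IsBig (G : Type*) [Group G] : Prop :=
  ∃ H : Subgroup G, Nonempty (H ≃* FreeGroup (Fin 2))

section

open Set unitInterval

/-- Paths with the same endpoints inside a simply connected subset are homotopic. -/
theorem IsSimplyConnected.homotopic_of_forall_mem {X : Type*} [TopologicalSpace X] {S : Set X}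
    (hS : IsSimplyConnected S) {x y : X} (γ γ' : Path x y) (h : ∀ t, γ t ∈ S)
    (h' : ∀ t, γ' t ∈ S) : γ.Homotopic γ' := by
  have := hS.simplyConnectedSpace
  have hx : x ∈ S := by simpa using h 0
  have hy : y ∈ S := by simpa using h 1
  let δ : Path (⟨x, hx⟩ : S) ⟨y, hy⟩ :=
    ⟨⟨fun t => ⟨γ t, h t⟩, by fun_prop⟩, by simp, by simp⟩
  let δ' : Path (⟨x, hx⟩ : S) ⟨y, hy⟩ :=
    ⟨⟨fun t => ⟨γ' t, h' t⟩, by fun_prop⟩, by simp, by simp⟩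
  exact (SimplyConnectedSpace.paths_homotopic δ δ').map ⟨_, continuous_subtype_val⟩

/-- A space covered by two open simply connected subsets with path connected intersection is
simply connected. -/
theorem simplyConnectedSpace_of_union {X : Type*} [TopologicalSpace X] {U V : Set X}
    (hU : IsOpen U) (hV : IsOpen V) (sU : IsSimplyConnected U) (sV : IsSimplyConnected V)
    (hUV : IsPathConnected (U ∩ V)) (hcov : U ∪ V = univ) : SimplyConnectedSpace X := by
  obtain ⟨x₀, hx₀, hj⟩ := hUV
  have key : ∀ y, ∃ c : Path x₀ y, ∀ S, (S = U ∨ S = V) → ∀ δ : Path x₀ y, (∀ t, δ t ∈ S) →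
      δ.Homotopic c := by
    intro y
    by_cases hyU : y ∈ U
    · by_cases hyV : y ∈ V
      · obtain ⟨c, hc⟩ := hj ⟨hyU, hyV⟩
        refine ⟨c, ?_⟩
        rintro S (rfl | rfl) δ hδ
        · exact sU.homotopic_of_forall_mem _ _ hδ fun t => (hc t).1
        · exact sV.homotopic_of_forall_mem _ _ hδ fun t => (hc t).2
      · obtain ⟨c, hc⟩ := sU.isPathConnected.joinedIn _ hx₀.1 _ hyU
        refine ⟨c, ?_⟩
        rintro S (rfl | rfl) δ hδ
        · exact sU.homotopic_of_forall_mem _ _ hδ hc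
        · exact absurd (by simpa using hδ 1) hyV
    · have hyV : y ∈ V := by
        have : y ∈ U ∪ V := hcov ▸ mem_univ y
        exact this.resolve_left hyU
      obtain ⟨c, hc⟩ := sV.isPathConnected.joinedIn _ hx₀.2 _ hyV
      refine ⟨c, ?_⟩
      rintro S (rfl | rfl) δ hδ
      · exact absurd (by simpa using hδ 1) hyU
      · exact sV.homotopic_of_forall_mem _ _ hδ hc
  choose c hc using key
  have hjoin : ∀ S, (S = U ∨ S = V) → ∀ y ∈ S, ∃ δ : Path x₀ y, ∀ t, δ t ∈ S := by
    rintro S (rfl | rfl) y hy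
    · exact sU.isPathConnected.joinedIn _ hx₀.1 _ hy
    · exact sV.isPathConnected.joinedIn _ hx₀.2 _ hy
  have step : ∀ S, (S = U ∨ S = V) → ∀ a b (γ : Path a b), (∀ t, γ t ∈ S) →
      ((c a).trans γ).Homotopic (c b) := by
    intro S hS a b γ hγ
    obtain ⟨δ, hδ⟩ := hjoin S hS a (by simpa using hγ 0)
    have h1 : (δ.trans γ).Homotopic (c b) := by
      refine hc b S hS _ fun t => ?_
      have : (δ.trans γ) t ∈ range (δ.trans γ) := mem_range_self t
      rw [Path.trans_range] at this
      rcases this with ⟨s, hs⟩ | ⟨s, hs⟩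
      · exact hs ▸ hδ s
      · exact hs ▸ hγ s
    exact (((hc a S hS δ hδ).symm).hcomp (Path.Homotopic.refl γ)).trans h1
  have all : ∀ a b (γ : Path a b), ((c a).trans γ).Homotopic (c b) := by
    intro a b γ
    obtain ⟨t, t0, tm, ⟨N, hN⟩, ht⟩ := exists_monotone_Icc_subset_open_cover_unitInterval
      (c := fun i : Bool => γ ⁻¹' (if i then U else V))
      (fun i => by cases i <;> simp [hU.preimage γ.continuous, hV.preimage γ.continuous])
      (fun s _ => by
        have : γ s ∈ U ∪ V := hcov ▸ mem_univ _
        rcases this with h | h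
        · exact mem_iUnion.2 ⟨true, by simpa using h⟩
        · exact mem_iUnion.2 ⟨false, by simpa using h⟩)
    have ind : ∀ n, ((c (γ 0)).trans (γ.subpath 0 (t n))).Homotopic (c (γ (t n))) := by
      intro n
      induction n with
      | zero =>
        rw [t0, Path.subpath_self]
        exact ⟨Path.Homotopy.transRefl _⟩
      | succ n ih =>
        obtain ⟨i, hi⟩ := ht n
        have h1 := step (if i then U else V) (by cases i <;> simp) _ _
          (γ.subpath (t n) (t (n + 1))) (fun s => by
            have : (γ.subpath (t n) (t (n + 1))) s ∈ range (γ.subpath (t n) (t (n + 1))) :=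
              mem_range_self s
            rw [Path.range_subpath_of_le _ _ _ (tm n.le_succ)] at this
            obtain ⟨r, hr, hr'⟩ := this
            exact hr' ▸ hi hr)
        have h2 : (γ.subpath 0 (t (n + 1))).Homotopic
            ((γ.subpath 0 (t n)).trans (γ.subpath (t n) (t (n + 1)))) :=
          Path.Homotopic.symm ⟨Path.Homotopy.subpathTransSubpath γ 0 (t n) (t (n + 1))⟩
        refine ((Path.Homotopic.refl _).hcomp h2).trans ?_
        refine Path.Homotopic.trans ?_ h1
        refine Path.Homotopic.trans ?_ (ih.hcomp (Path.Homotopic.refl _))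
        exact Path.Homotopic.symm ⟨Path.Homotopy.transAssoc _ _ _⟩
    have h := ind N
    rw [hN N le_rfl, Path.subpath_zero_one] at h
    obtain ⟨γ, rfl, rfl⟩ := γ
    exact h
  rw [simply_connected_iff_paths_homotopic']
  refine ⟨⟨⟨x₀⟩, fun x y => ⟨(c x).symm.trans (c y)⟩⟩, fun {x y} p q => ?_⟩
  have h := (all x y p).trans (all x y q).symm
  have canc : ∀ p : Path x y, ((c x).symm.trans ((c x).trans p)).Homotopic p := fun p =>
    (Path.Homotopic.symm ⟨Path.Homotopy.transAssoc _ _ _⟩).trans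
      ((Path.Homotopic.hcomp (Path.Homotopic.symm ⟨Path.Homotopy.reflSymmTrans _⟩)
        (Path.Homotopic.refl p)).trans ⟨Path.Homotopy.reflTrans p⟩)
  exact (canc p).symm.trans (((Path.Homotopic.refl _).hcomp h).trans (canc q))

/-- The bundle with discrete fibre `G` obtained by gluing trivial bundles over two open sets `U`
and `V` along a locally constant function `τ` on `U ∩ V`. -/
def gluedBundleCore {W G : Type*} [TopologicalSpace W] [Group G] [TopologicalSpace G]
    [DiscreteTopology G] (U V : Set W) (hU : IsOpen U) (hV : IsOpen V) (hcov : U ∪ V = univ)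
    (τ : W → G) (hτ : ContinuousOn τ (U ∩ V)) : FiberBundleCore Bool W G where
  baseSet i := bif i then U else V
  isOpen_baseSet i := by cases i <;> assumption
  indexAt w := open Classical in decide (w ∈ U)
  mem_baseSet_at w := by
    by_cases h : w ∈ U
    · simp [h]
    · have : w ∈ U ∪ V := hcov ▸ mem_univ w
      simpa [h] using this
  coordChange i j w g := (bif j then τ w else 1)⁻¹ * (bif i then τ w else 1) * g
  coordChange_self i w _ g := by simp
  continuousOn_coordChange i j := by
    have h1 : ContinuousOn (fun p : W × G => τ p.1) ((U ∩ V) ×ˢ univ) :=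
      hτ.comp continuousOn_fst fun p hp => hp.1
    cases i <;> cases j <;> simp only [cond_true, cond_false, inv_one, one_mul, mul_one,
      inv_mul_cancel]
    · exact continuousOn_snd
    · rw [inter_comm]
      exact h1.inv.mul continuousOn_snd
    · exact h1.mul continuousOn_snd
    · exact continuousOn_snd
  coordChange_comp i j k w _ g := by simp [mul_assoc]

/-- A space covered by two open sets `U` and `V` together with a locally constant function on
`U ∩ V` whose values contain free generators contains a free group in its fundamental group. -/
theorem exists_injective_freeGroup_fundamentalGroup {W ι : Type*} [TopologicalSpace W]
    {U V : Set W} (hU : IsOpen U) (hV : IsOpen V) (hcov : U ∪ V = univ)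
    (τ : W → FreeGroup ι) (hτ : ∀ w ∈ U ∩ V, ∀ᶠ w' in nhds w, τ w' = τ w) {w₀ : W}
    (hτ₀ : τ w₀ = 1) (x : ι → W) (hx : ∀ i, τ (x i) = FreeGroup.of i)
    (jU : ∀ i, JoinedIn U w₀ (x i)) (jV : ∀ i, JoinedIn V w₀ (x i)) :
    ∃ f : FreeGroup ι →* FundamentalGroup W w₀, Function.Injective f := by
  let _ : TopologicalSpace (FreeGroup ι) := ⊥
  have : DiscreteTopology (FreeGroup ι) := ⟨rfl⟩
  have hτc : ContinuousOn τ (U ∩ V) := fun w hw =>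
    (continuousAt_const.congr ((hτ w hw).mono fun _ h => h.symm)).continuousWithinAt
  let Z := gluedBundleCore U V hU hV hcov τ hτc
  have cov : IsCoveringMap Z.proj :=
    IsCoveringMap.mk _ _ (fun w => Z.localTriv (Z.indexAt w)) fun w => Z.mem_baseSet_at w
  let s : Bool → W → FreeGroup ι → Z.TotalSpace := fun i w g =>
    ⟨w, Z.coordChange i (Z.indexAt w) w g⟩
  have hs : ∀ w g, s true w g = s false w (τ w * g) := fun w g => by
    simp [s, Z, gluedBundleCore, mul_assoc]
  have mono : ∀ (i : Bool) {a b : W} (γ : Path a b), (∀ t, γ t ∈ Z.baseSet i) → ∀ g,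
      cov.monodromy (Path.Homotopic.Quotient.mk γ) ⟨s i a g, rfl⟩ = ⟨s i b g, rfl⟩ := by
    intro i a b γ hγ g
    have hcont : Continuous fun t => s i (γ t) g := by
      have h1 := (Z.localTriv i).continuousOn_invFun
      have h2 : Continuous fun t => (γ t, g) := by fun_prop
      exact h1.comp_continuous h2 fun t => by
        have := hγ t
        simpa [(Z.localTriv i).target_eq] using this
    let Γ : Path (s i a g) (s i b g) := ⟨⟨fun t => s i (γ t) g, hcont⟩, by simp, by simp⟩
    exact cov.monodromy_eq_of_map_eq (Path.Homotopic.Quotient.mk Γ) rfl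
  choose p hp using jU
  choose q hq using jV
  let f : FreeGroup ι →* FundamentalGroup W w₀ := FreeGroup.lift fun i =>
    (FundamentalGroup.fromPath (Path.Homotopic.Quotient.mk ((p i).trans (q i).symm)))
  have hs₀ : ∀ g, s true w₀ g = s false w₀ g := fun g => by rw [hs, hτ₀, one_mul]
  have hgen : ∀ i g, cov.monodromyPerm w₀ (f (FreeGroup.of i)) ⟨s false w₀ g, rfl⟩ =
      ⟨s false w₀ (FreeGroup.of i * g), rfl⟩ := by
    intro i g
    simp only [f, FreeGroup.lift_apply_of, IsCoveringMap.coe_monodromyPerm]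
    change cov.monodromy ((Path.Homotopic.Quotient.mk (p i)).trans
      (Path.Homotopic.Quotient.mk (q i).symm)) _ = _
    rw [cov.monodromy_trans_apply]
    have h1 := mono true (p i) (fun t => hp i t) g
    simp only [hs₀] at h1
    rw [h1]
    have h2 := mono false (q i).symm (fun t => hq i _) (FreeGroup.of i * g)
    rw [← h2]
    congr 2
    rw [hs, hx]
  have hall : ∀ w g, cov.monodromyPerm w₀ (f w) ⟨s false w₀ g, rfl⟩ =
      ⟨s false w₀ (w * g), rfl⟩ := by
    intro w
    induction w using FreeGroup.induction_on with
    | C1 => intro g; rw [map_one, map_one, Equiv.Perm.one_apply, one_mul]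
    | of i => exact hgen i
    | inv_of i _ =>
      intro g
      rw [map_inv, map_inv, Equiv.Perm.inv_eq_iff_eq, hgen]
      simp
    | mul a b ha hb =>
      intro g
      rw [map_mul, map_mul, Equiv.Perm.mul_apply, hb, ha, mul_assoc]
  refine ⟨f, fun a b hab => ?_⟩
  have h := (hall a 1).symm.trans ((by rw [hab]) : _ = _) |>.trans (hall b 1)
  have h3 := congrArg (fun e => Z.coordChange (Z.indexAt e.1.1) false e.1.1 e.1.2) h
  simpa [s, Z, gluedBundleCore] using h3

/-- The conic complement's double cover `{q = 1}`, with the part over a closed set removed. -/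
abbrev unitLevel (q : (Fin 3 → ℂ) → ℂ) (S : Set P2) : Type :=
  {v : Fin 3 → ℂ // q v = 1 ∧ ∃ h : v ≠ 0, Projectivization.mk ℂ v h ∉ S}

theorem continuous_projectivization_mk :
    Continuous fun v : {v : Fin 3 → ℂ // v ≠ 0} => (Projectivization.mk ℂ v.1 v.2 : P2) :=
  continuous_quotient_mk'

section doubleCover

variable {q : (Fin 3 → ℂ) → ℂ} {S : Set P2}

theorem mk_neg_eq (v : Fin 3 → ℂ) (h : v ≠ 0) (h' : -v ≠ 0) :
    (Projectivization.mk ℂ (-v) h' : P2) = Projectivization.mk ℂ v h :=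
  (Projectivization.mk_eq_mk_iff' ..).2 ⟨(-1 : ℂ), by simp⟩

/-- The projection from the level set `{q = 1}` to the projective plane. -/
def unitLevelProj (q : (Fin 3 → ℂ) → ℂ) (S : Set P2) : unitLevel q S → ↥(Sᶜ) :=
  fun v => ⟨Projectivization.mk ℂ v.1 v.2.2.1, v.2.2.2⟩

/-- The action of the sign group on the level set `{q = 1}`. -/
@[reducible] def unitLevelAction (hq : ∀ (c : ℂ) v, q (c • v) = c ^ 2 * q v) :
    MulAction ℤˣ (unitLevel q S) where
  smul u v := ⟨u • v.1, by
    rcases Int.units_eq_one_or u with rfl | rfl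
    · simpa using v.2
    · have h0 : -v.1 ≠ 0 := neg_ne_zero.2 v.2.2.1
      refine ⟨?_, ?_⟩
      · have := hq (-1) v.1
        simpa [Units.smul_def, v.2.1] using this
      · obtain ⟨_, h, h'⟩ := v.2
        have e : ((-1 : ℤˣ) • v.1) = -v.1 := by simp [Units.smul_def]
        rw [e]
        exact ⟨h0, by rwa [mk_neg_eq v.1 h h0]⟩⟩
  one_smul v := Subtype.ext (one_smul _ _)
  mul_smul a b v := Subtype.ext (mul_smul _ _ _)

theorem isQuotientCoveringMap_unitLevelProj (hc : Continuous q)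
    (hq : ∀ (c : ℂ) v, q (c • v) = c ^ 2 * q v)
    (hS : ∀ (v : Fin 3 → ℂ) (h : v ≠ 0), Projectivization.mk ℂ v h ∉ S → q v ≠ 0) :
    letI := unitLevelAction (S := S) hq
    IsQuotientCoveringMap (unitLevelProj q S) ℤˣ := by
  let _ := unitLevelAction (S := S) hq
  have hneg : ∀ v : unitLevel q S, ((-1 : ℤˣ) • v).1 = -v.1 := fun v => by
    change (-1 : ℤˣ) • v.1 = -v.1
    simp [Units.smul_def]
  have hcont : Continuous (unitLevelProj q S) := by
    refine Continuous.subtype_mk ?_ _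
    exact continuous_projectivization_mk.comp
      (Continuous.subtype_mk continuous_subtype_val fun v => v.2.2.1)
  have hsurj : Function.Surjective (unitLevelProj q S) := by
    rintro ⟨x, hx⟩
    induction x using Projectivization.ind with
    | h v hv =>
      have hqv := hS v hv hx
      obtain ⟨c, hc⟩ := IsAlgClosed.exists_pow_nat_eq (q v)⁻¹ two_pos
      have hc0 : c ≠ 0 := by
        rintro rfl
        simp [hqv, eq_comm] at hc
      have hcv : c • v ≠ 0 := smul_ne_zero hc0 hv
      have e : (Projectivization.mk ℂ (c • v) hcv : P2) = Projectivization.mk ℂ v hv :=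
        (Projectivization.mk_eq_mk_iff' ..).2 ⟨c, rfl⟩
      exact ⟨⟨c • v, by rw [hq, hc, inv_mul_cancel₀ hqv], hcv, by rwa [e]⟩, Subtype.ext e⟩
  have hopen : IsOpenMap (unitLevelProj q S) := by
    rintro _ ⟨W, hW, rfl⟩
    let O : Set P2 := {x | ∃ (v : Fin 3 → ℂ) (h : v ≠ 0),
      x = Projectivization.mk ℂ v h ∧ v ∈ W ∧ q v = 1}
    have hO : IsOpen O := by
      have h1 : IsOpen {v : Fin 3 → ℂ | ∃ c : ℂ, c • v ∈ W ∧ c ^ 2 * q v = 1} := by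
        rw [isOpen_iff_mem_nhds]
        rintro v ⟨c, hcW, hc1⟩
        have hr : ContinuousAt (fun w => (c ^ 2 * q w) ^ (-(1 / 2) : ℂ)) v :=
          ContinuousAt.cpow (by fun_prop) continuousAt_const (by simp [hc1])
        have hct : ContinuousAt (fun w => (c * (c ^ 2 * q w) ^ (-(1 / 2) : ℂ)) • w) v :=
          (hr.const_mul c).smul continuousAt_id
        have h2 : ∀ᶠ w in nhds v, (c * (c ^ 2 * q w) ^ (-(1 / 2) : ℂ)) • w ∈ W := by
          refine hct.eventually_mem (hW.mem_nhds ?_)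
          simpa [hc1] using hcW
        have h3 : ∀ᶠ w in nhds v, c ^ 2 * q w ≠ 0 :=
          ContinuousAt.eventually_ne (g := fun w => c ^ 2 * q w) (by fun_prop) (by rw [hc1]; exact one_ne_zero)
        filter_upwards [h2, h3] with w hw hw'
        refine ⟨_, hw, ?_⟩
        have : ((c ^ 2 * q w) ^ (-(1 / 2) : ℂ)) ^ 2 = (c ^ 2 * q w)⁻¹ := by
          rw [← Complex.cpow_nat_mul, ← Complex.cpow_neg_one]
          norm_num
        rw [mul_pow, this, mul_right_comm, mul_inv_cancel₀ hw']
      refine isOpen_coinduced.2 ?_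
      convert h1.preimage (continuous_subtype_val (p := fun v : Fin 3 → ℂ => v ≠ 0)) using 1
      ext ⟨v, hv⟩
      constructor
      · rintro ⟨w, hw, e, hwW, hw1⟩
        obtain ⟨c, rfl⟩ := (Projectivization.mk_eq_mk_iff' ℂ _ _ hw hv).1 e.symm
        exact ⟨c, hwW, by rw [← hq, hw1]⟩
      · rintro ⟨c, hcW, hc1⟩
        have hc0 : c ≠ 0 := by
          rintro rfl
          simp at hc1
        exact ⟨c • v, smul_ne_zero hc0 hv,
          ((Projectivization.mk_eq_mk_iff' ..).2 ⟨c, rfl⟩ : Projectivization.mk ℂ (c • v) _ =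
            Projectivization.mk ℂ v hv).symm, hcW, by rw [hq, hc1]⟩
    refine ⟨O, hO, ?_⟩
    ext ⟨x, hx⟩
    simp only [mem_preimage, mem_image]
    constructor
    · rintro ⟨v, h, rfl, hvW, hv1⟩
      exact ⟨⟨v, hv1, h, hx⟩, hvW, rfl⟩
    · rintro ⟨⟨v, hv1, h, hvS⟩, hvW, e⟩
      exact ⟨v, h, congrArg Subtype.val e.symm, hvW, hv1⟩
  refine { toIsQuotientMap := hopen.isQuotientMap hcont hsurj, continuous_const_smul := ?_,
           apply_eq_iff_mem_orbit := ?_, disjoint := ?_ }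
  · intro u
    refine Continuous.subtype_mk (f := fun v : unitLevel q S => u • v.1) ?_ _
    rcases Int.units_eq_one_or u with rfl | rfl
    · simpa using continuous_subtype_val
    · simp only [Units.smul_def, Units.val_neg, Units.val_one, neg_smul, one_smul]
      exact continuous_subtype_val.neg
  · intro v w
    constructor
    · intro h
      obtain ⟨c, hc⟩ := (Projectivization.mk_eq_mk_iff' ..).1 (congrArg Subtype.val h)
      have hc1 : c ^ 2 = 1 := by
        have := hq c w.1
        rw [hc, v.2.1, w.2.1] at this
        simpa using this.symm
      rcases (show c = 1 ∨ c = -1 by simpa using hc1) with rfl | rfl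
      · exact ⟨1, Subtype.ext (by simpa using hc)⟩
      · exact ⟨-1, Subtype.ext (by rw [← hc]; simpa using hneg w)⟩
    · rintro ⟨u, rfl⟩
      rcases Int.units_eq_one_or u with rfl | rfl
      · simp
      · refine Subtype.ext ?_
        have h0 : -w.1 ≠ 0 := neg_ne_zero.2 w.2.2.1
        refine Eq.trans ?_ (mk_neg_eq w.1 w.2.2.1 h0)
        change Projectivization.mk ℂ ((-1 : ℤˣ) • w).1 _ = _
        simp only [hneg]
  · intro v
    have hv : v.1 ≠ -v.1 := fun h => v.2.2.1 (self_eq_neg.1 h)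
    obtain ⟨A, B, hA, hB, hvA, hvB, hAB⟩ := t2_separation hv
    refine ⟨Subtype.val ⁻¹' (A ∩ Neg.neg ⁻¹' B), ?_, ?_⟩
    · exact ((hA.inter (hB.preimage continuous_neg)).preimage
        continuous_subtype_val).mem_nhds ⟨hvA, hvB⟩
    · rintro g ⟨_, ⟨w, hw, rfl⟩, hw'⟩
      rcases Int.units_eq_one_or g with rfl | rfl
      · rfl
      · refine (disjoint_left.1 hAB hw'.1 ?_).elim
        simpa [hneg] using hw.2

end doubleCover

/-- The complement is abelian when the double cover is simply connected. -/
theorem mul_comm_fundamentalGroup_of_unitLevel {q : (Fin 3 → ℂ) → ℂ} {S : Set P2}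
    (hc : Continuous q) (hq : ∀ (c : ℂ) v, q (c • v) = c ^ 2 * q v)
    (hS : ∀ (v : Fin 3 → ℂ) (h : v ≠ 0), Projectivization.mk ℂ v h ∉ S → q v ≠ 0)
    [SimplyConnectedSpace (unitLevel q S)] (x : ↥(Sᶜ)) (a b : FundamentalGroup ↥(Sᶜ) x) :
    a * b = b * a := by
  let _ := unitLevelAction (S := S) hq
  have hp := isQuotientCoveringMap_unitLevelProj hc hq hS
  obtain ⟨e, he⟩ := hp.surjective x
  refine (hp.fundamentalGroupEquiv ⟨e, he⟩).injective ?_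
  rw [map_mul, map_mul, mul_comm]

theorem isBig_of_injective {G : Type*} [Group G] (f : FreeGroup (Fin 2) →* G)
    (hf : Function.Injective f) : IsBig G :=
  ⟨f.range, ⟨(MonoidHom.ofInjective hf).symm⟩⟩

/-- A free subgroup in the fundamental group of the double cover makes that of the complement
big. -/
theorem isBig_fundamentalGroup_of_unitLevel {q : (Fin 3 → ℂ) → ℂ} {S : Set P2}
    (hc : Continuous q) (hq : ∀ (c : ℂ) v, q (c • v) = c ^ 2 * q v)
    (hS : ∀ (v : Fin 3 → ℂ) (h : v ≠ 0), Projectivization.mk ℂ v h ∉ S → q v ≠ 0)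
    [PathConnectedSpace ↥(Sᶜ)] (w : unitLevel q S)
    (hw : ∃ f : FreeGroup (Fin 2) →* FundamentalGroup (unitLevel q S) w, Function.Injective f)
    (x : ↥(Sᶜ)) : IsBig (FundamentalGroup ↥(Sᶜ) x) := by
  let _ := unitLevelAction (S := S) hq
  have hp := isQuotientCoveringMap_unitLevelProj hc hq hS
  obtain ⟨f, hf⟩ := hw
  have h1 : Function.Injective
      (FundamentalGroup.map (⟨_, hp.continuous⟩ : C(unitLevel q S, ↥(Sᶜ))) w) :=
    hp.isCoveringMap.injective_path_homotopic_map w w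
  let e := FundamentalGroup.fundamentalGroupMulEquivOfPathConnected (X := ↥(Sᶜ))
    (unitLevelProj q S w) x
  exact isBig_of_injective (e.toMonoidHom.comp ((FundamentalGroup.map
    (⟨_, hp.continuous⟩ : C(unitLevel q S, ↥(Sᶜ))) w).comp f))
    (e.injective.comp (h1.comp hf))

section quadric

/-- The polar form of a quadratic form in three variables. -/
theorem MvPolynomial.IsHomogeneous.exists_polar {P : MvPolynomial (Fin 3) ℂ}
    (hP : P.IsHomogeneous 2) : ∃ B : LinearMap.BilinForm ℂ (Fin 3 → ℂ), (∀ v w, B v w = B w v) ∧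
      (∀ v w, B v w = ∑ i, gradP P v i * w i) ∧ ∀ v, B v v = 2 * eval v P := by
  let h : Matrix (Fin 3) (Fin 3) ℂ := fun i j => eval 0 (pderiv j (pderiv i P))
  have hsymm : ∀ i j, h i j = h j i := fun i j => by
    have e : ⁅(pderiv j : Derivation ℂ (MvPolynomial (Fin 3) ℂ) (MvPolynomial (Fin 3) ℂ)),
        pderiv i⁆ = 0 := MvPolynomial.derivation_ext fun k => by
      rw [Derivation.commutator_apply]
      simp only [pderiv_X, Pi.single_apply]
      split_ifs <;> simp
    have e' := congrArg (fun D => eval 0 (D P)) e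
    simpa [h, Derivation.commutator_apply, sub_eq_zero] using e'
  have h1 : ∀ i, (pderiv i P).IsHomogeneous 1 := fun i => hP.pderiv
  have hgrad : ∀ v i, gradP P v i = ∑ j, h i j * v j := fun v i => by
    have e := congrArg (eval v) (h1 i).sum_X_mul_pderiv
    have hC : ∀ j, eval v (pderiv j (pderiv i P)) = h i j := fun j => by
      have h0 : (pderiv j (pderiv i P)).IsHomogeneous 0 := (h1 i).pderiv
      rw [← totalDegree_zero_iff_isHomogeneous, totalDegree_eq_zero_iff_eq_C] at h0
      change _ = eval 0 _
      rw [h0, eval_C, eval_C]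
    simp only [map_sum, map_mul, eval_X, hC, one_smul] at e
    rw [gradP, ← e]
    exact Finset.sum_congr rfl fun j _ => mul_comm _ _
  have hpol : ∀ v w, Matrix.toBilin' h v w = ∑ i, gradP P v i * w i := fun v w => by
    rw [Matrix.toBilin'_apply']
    simp [dotProduct, Matrix.mulVec, hgrad, Fin.sum_univ_three]
    rw [hsymm 1 0, hsymm 2 0, hsymm 2 1]
    ring
  refine ⟨Matrix.toBilin' h, fun v w => ?_, hpol, fun v => ?_⟩
  · simp only [Matrix.toBilin'_apply, Fin.sum_univ_three]
    rw [hsymm 1 0, hsymm 2 0, hsymm 2 1]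
    ring
  · rw [hpol]
    have e := congrArg (eval v) hP.sum_X_mul_pderiv
    simp only [map_sum, map_mul, eval_X] at e
    simpa [gradP, mul_comm] using e

theorem MvPolynomial.IsHomogeneous.eval_smul_two {P : MvPolynomial (Fin 3) ℂ}
    (hP : P.IsHomogeneous 2) (c : ℂ) (v : Fin 3 → ℂ) : eval (c • v) P = c ^ 2 * eval v P := by
  obtain ⟨B, -, -, hB⟩ := hP.exists_polar
  have h1 := hB (c • v)
  rw [map_smul, map_smul, LinearMap.smul_apply, hB, smul_eq_mul, smul_eq_mul] at h1
  linear_combination -(1 / 2) * h1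

theorem mk_mem_zeroLocusP2 {P : MvPolynomial (Fin 3) ℂ} (hP : P.IsHomogeneous 2)
    {v : Fin 3 → ℂ} (hv : v ≠ 0) :
    Projectivization.mk ℂ v hv ∈ zeroLocusP2 P ↔ eval v P = 0 := by
  obtain ⟨a, ha⟩ := Projectivization.exists_smul_eq_mk_rep ℂ v hv
  change eval (Projectivization.mk ℂ v hv).rep P = 0 ↔ _
  rw [← ha, Units.smul_def, hP.eval_smul_two]
  simp

/-- A smooth conic through `p` has the equation `y ^ 2 + x * z` in suitable coordinates, with `p`
the first coordinate vector. -/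
theorem exists_conic_coordinates {P : MvPolynomial (Fin 3) ℂ} (hP : P.IsHomogeneous 2)
    (hgrad : ∀ v : Fin 3 → ℂ, v ≠ 0 → gradP P v ≠ 0) {p : Fin 3 → ℂ} (hp : p ≠ 0)
    (hpP : eval p P = 0) : ∃ Φ : (Fin 3 → ℂ) ≃ₗ[ℂ] (Fin 3 → ℂ),
      (∀ v, eval (Φ v) P = v 1 ^ 2 + v 0 * v 2) ∧ Φ ![1, 0, 0] = p := by
  obtain ⟨B, hsymm, hB, hBP⟩ := hP.exists_polar
  have nondeg : ∀ v, v ≠ 0 → ∃ w, B v w ≠ 0 := fun v hv => by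
    obtain ⟨i, hi⟩ := Function.ne_iff.1 (hgrad v hv)
    refine ⟨Pi.single i 1, ?_⟩
    rw [hB]
    simpa [Pi.single_apply] using hi
  have hpp : B p p = 0 := by rw [hBP, hpP, mul_zero]
  obtain ⟨f, hpf, hff⟩ : ∃ f, B p f = 1 ∧ B f f = 0 := by
    obtain ⟨w, hw⟩ := nondeg p hp
    refine ⟨(B p w)⁻¹ • w - ((B p w)⁻¹ ^ 2 * B w w / 2) • p, ?_, ?_⟩
    · simp [hpp, hw]
    · simp [hpp, hsymm w p]
      field_simp
      ring
  have hfp : B f p = 1 := by rw [hsymm, hpf]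
  obtain ⟨u₀, hu₀, hpu₀, hfu₀⟩ : ∃ u, u ≠ 0 ∧ B p u = 0 ∧ B f u = 0 := by
    obtain ⟨u, hu, hu0⟩ := (Submodule.ne_bot_iff _).1
      (LinearMap.ker_ne_bot_of_finrank_lt (f := (B p).prod (B f)) (by simp))
    have := LinearMap.mem_ker.1 hu
    exact ⟨u, hu0, congrArg Prod.fst this, congrArg Prod.snd this⟩
  obtain ⟨u₁, hpu₁, hfu₁, huu₁⟩ : ∃ u, B p u = 0 ∧ B f u = 0 ∧ B u u ≠ 0 := by
    by_cases h0 : B u₀ u₀ = 0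
    · obtain ⟨w, hw⟩ := nondeg u₀ hu₀
      let w' := w - B f w • p - B p w • f
      have hw1 : B p w' = 0 := by simp [w', hpp, hpf]
      have hw2 : B f w' = 0 := by simp [w', hff, hfp]
      have hw3 : B u₀ w' = B u₀ w := by simp [w', hsymm u₀, hpu₀, hfu₀]
      by_cases h1 : B w' w' = 0
      · refine ⟨u₀ + w', by simp [hpu₀, hw1], by simp [hfu₀, hw2], ?_⟩
        simp [h0, h1, hsymm w' u₀, hw3, hw]
      · exact ⟨w', hw1, hw2, h1⟩
    · exact ⟨u₀, hpu₀, hfu₀, h0⟩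
  obtain ⟨c, hc⟩ := IsAlgClosed.exists_pow_nat_eq (2 / B u₁ u₁) two_pos
  let u := c • u₁
  have hpu : B p u = 0 := by simp [u, hpu₁]
  have hfu : B f u = 0 := by simp [u, hfu₁]
  have hup : B u p = 0 := by rw [hsymm, hpu]
  have huf : B u f = 0 := by rw [hsymm, hfu]
  have huu : B u u = 2 := by
    have : B u u = c ^ 2 * B u₁ u₁ := by simp [u]; ring
    rw [this, hc, div_mul_cancel₀ _ huu₁]
  let Ψ : (Fin 3 → ℂ) →ₗ[ℂ] (Fin 3 → ℂ) :=
    (LinearMap.proj 0).smulRight p + (LinearMap.proj 1).smulRight u +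
      (LinearMap.proj 2).smulRight f
  have hΨ : ∀ v, Ψ v = v 0 • p + v 1 • u + v 2 • f := fun v => rfl
  have hinj : Function.Injective Ψ := by
    rw [injective_iff_map_eq_zero]
    intro v hv
    have e0 := congrArg (B f) hv
    have e1 := congrArg (B u) hv
    have e2 := congrArg (B p) hv
    simp [hΨ, hfp, hfu, hff] at e0
    simp [hΨ, hup, huu, huf] at e1
    simp [hΨ, hpp, hpu, hpf] at e2
    ext i
    fin_cases i <;> simpa
  refine ⟨LinearEquiv.ofInjectiveEndo Ψ hinj, fun v => ?_, ?_⟩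
  · have : B (Ψ v) (Ψ v) = 2 * (v 1 ^ 2 + v 0 * v 2) := by
      simp [hΨ, hfp, hfu, hff, hup, huu, huf, hpp, hpu, hpf]
      ring
    rw [hBP] at this
    exact mul_left_cancel₀ two_ne_zero this
  · simp [hΨ]

/-- The equation of a smooth conic in given linear coordinates. -/
theorem exists_conic_coefficients {P : MvPolynomial (Fin 3) ℂ} (hP : P.IsHomogeneous 2)
    (hgrad : ∀ v : Fin 3 → ℂ, v ≠ 0 → gradP P v ≠ 0) (Φ : (Fin 3 → ℂ) ≃ₗ[ℂ] (Fin 3 → ℂ)) :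
    ∃ a b c d e f : ℂ,
      (∀ x y z, eval (Φ ![x, y, z]) P =
        a * x ^ 2 + b * y ^ 2 + c * z ^ 2 + d * (x * y) + e * (x * z) + f * (y * z)) ∧
      ∀ x y z, 2 * a * x + d * y + e * z = 0 → d * x + 2 * b * y + f * z = 0 →
        e * x + f * y + 2 * c * z = 0 → x = 0 ∧ y = 0 ∧ z = 0 := by
  obtain ⟨B, hsymm, hB, hBP⟩ := hP.exists_polar
  let k : Fin 3 → Fin 3 → ℂ := fun i j => B (Φ (Pi.single i 1)) (Φ (Pi.single j 1))
  have hexp : ∀ x y z : ℂ, (![x, y, z] : Fin 3 → ℂ) =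
      x • Pi.single 0 1 + y • Pi.single 1 1 + z • Pi.single 2 1 := fun x y z => by
    ext i
    fin_cases i <;> simp
  have hk : ∀ i j, k i j = k j i := fun i j => hsymm _ _
  refine ⟨k 0 0 / 2, k 1 1 / 2, k 2 2 / 2, k 0 1, k 0 2, k 1 2, fun x y z => ?_,
    fun x y z h0 h1 h2 => ?_⟩
  · refine mul_left_cancel₀ (two_ne_zero (α := ℂ)) ?_
    rw [← hBP, hexp]
    simp only [map_add, map_smul, LinearMap.add_apply, LinearMap.smul_apply, smul_eq_mul]
    change x * (x * k 0 0 + y * k 1 0 + z * k 2 0) + y * (x * k 0 1 + y * k 1 1 + z * k 2 1) +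
      z * (x * k 0 2 + y * k 1 2 + z * k 2 2) = _
    rw [hk 1 0, hk 2 0, hk 2 1]
    ring
  · have hzero : Φ ![x, y, z] = 0 := by
      by_contra hne
      obtain ⟨i, hi⟩ := Function.ne_iff.1 (hgrad _ hne)
      have h3 : ∀ j, B (Φ ![x, y, z]) (Φ (Pi.single j 1)) = 0 := by
        intro j
        rw [hexp]
        simp only [map_add, map_smul, LinearMap.add_apply, LinearMap.smul_apply, smul_eq_mul]
        change x * k 0 j + y * k 1 j + z * k 2 j = 0
        fin_cases j
        · simp only [Fin.zero_eta, hk 1 0, hk 2 0]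
          linear_combination h0
        · simp only [Fin.mk_one, hk 2 1]
          linear_combination h1
        · simp only [Fin.reduceFinMk]
          linear_combination h2
      have h4 : (B (Φ ![x, y, z])).comp Φ.toLinearMap = 0 :=
        LinearMap.pi_ext' fun j => LinearMap.ext_ring (by simpa using h3 j)
      have h5 : B (Φ ![x, y, z]) (Pi.single i 1) = 0 := by
        have := LinearMap.congr_fun h4 (Φ.symm (Pi.single i 1))
        simpa using this
      rw [hB] at h5
      exact hi (by simpa [Pi.single_apply] using h5)
    have := Φ.map_eq_zero_iff.1 hzero
    exact ⟨congrFun this 0, congrFun this 1, congrFun this 2⟩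

/-- A smooth conic has a point. -/
theorem exists_conic_point {P : MvPolynomial (Fin 3) ℂ} (hP : P.IsHomogeneous 2) :
    ∃ p : Fin 3 → ℂ, p ≠ 0 ∧ eval p P = 0 := by
  obtain ⟨B, hsymm, hB, hBP⟩ := hP.exists_polar
  let e₀ : Fin 3 → ℂ := Pi.single 0 1
  let e₁ : Fin 3 → ℂ := Pi.single 1 1
  by_cases h : B e₁ e₁ = 0
  · refine ⟨e₁, by simp [e₁], ?_⟩
    simpa [hBP] using h
  · obtain ⟨s, hs⟩ := IsAlgClosed.exists_pow_nat_eq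
      (discrim (B e₁ e₁) (2 * B e₀ e₁) (B e₀ e₀)) two_pos
    obtain ⟨t, ht⟩ := exists_quadratic_eq_zero h ⟨s, by rw [← hs, sq]⟩
    refine ⟨e₀ + t • e₁, fun h0 => ?_, ?_⟩
    · simpa [e₀, e₁] using congrFun h0 0
    · have : B (e₀ + t • e₁) (e₀ + t • e₁) = 0 := by
        rw [← ht]
        simp [hsymm e₁ e₀]
        ring
      rw [hBP] at this
      exact (mul_eq_zero.1 this).resolve_left two_ne_zero

theorem cubic_coeff_eq_zero_of_no_root {a b c d : ℂ}
    (h : ∀ y : ℂ, a * y ^ 3 + b * y ^ 2 + c * y + d ≠ 0) : a = 0 ∧ b = 0 ∧ c = 0 := by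
  let F : Cubic ℂ := ⟨a, b, c, d⟩
  have h0 : F.toPoly.degree = 0 := by
    by_contra hne
    obtain ⟨y, hy⟩ := IsAlgClosed.exists_root F.toPoly hne
    exact h y (by simpa [F, Cubic.toPoly, Polynomial.IsRoot] using hy)
  have h1 : F.toPoly = Polynomial.C (F.toPoly.coeff 0) :=
    Polynomial.eq_C_of_degree_le_zero h0.le
  have h2 : ∀ n, n ≠ 0 → F.toPoly.coeff n = 0 := fun n hn => by
    rw [h1, Polynomial.coeff_C, if_neg hn]
  refine ⟨?_, ?_, ?_⟩
  · simpa [F] using h2 3 (by norm_num)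
  · simpa [F] using h2 2 (by norm_num)
  · simpa [F] using h2 1 (by norm_num)

/-- The equation of a smooth conic meeting the conic `y ^ 2 + x * z` in a single point. -/
theorem exists_tangent_conic_equation {P : MvPolynomial (Fin 3) ℂ} (hP : P.IsHomogeneous 2)
    (hgrad : ∀ v : Fin 3 → ℂ, v ≠ 0 → gradP P v ≠ 0) (Φ : (Fin 3 → ℂ) ≃ₗ[ℂ] (Fin 3 → ℂ))
    (h0 : eval (Φ ![1, 0, 0]) P = 0) (h : ∀ y : ℂ, eval (Φ ![-y ^ 2, y, 1]) P ≠ 0) :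
    ∃ b c : ℂ, b ≠ 0 ∧ c ≠ 0 ∧
      ∀ x y z, eval (Φ ![x, y, z]) P = b * (y ^ 2 + x * z) + c * z ^ 2 := by
  obtain ⟨a, b, c, d, e, f, heq, hnd⟩ := exists_conic_coefficients hP hgrad Φ
  have ha : a = 0 := by simpa [heq] using h0
  subst ha
  have h1 : ∀ y : ℂ, (-d) * y ^ 3 + (b - e) * y ^ 2 + f * y + c ≠ 0 := fun y hy => by
    refine h y ?_
    rw [heq]
    linear_combination hy
  obtain ⟨hd, hbe, hf⟩ := cubic_coeff_eq_zero_of_no_root h1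
  have hd' : d = 0 := neg_eq_zero.1 hd
  have hb' : e = b := (sub_eq_zero.1 hbe).symm
  subst hd' hb' hf
  refine ⟨e, c, ?_, ?_, fun x y z => by rw [heq]; ring⟩
  · rintro rfl
    exact one_ne_zero (hnd 1 0 0 (by simp) (by simp) (by simp)).1
  · rintro rfl
    exact h1 0 (by simp)

/-- A smooth conic contains no line. -/
theorem finite_line_inter_conic {P : MvPolynomial (Fin 3) ℂ} (hP : P.IsHomogeneous 2)
    (hgrad : ∀ v : Fin 3 → ℂ, v ≠ 0 → gradP P v ≠ 0) (Φ : (Fin 3 → ℂ) ≃ₗ[ℂ] (Fin 3 → ℂ)) :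
    {z : ℂ | eval (Φ ![0, 1, z]) P = 0}.Finite := by
  obtain ⟨a, b, c, d, e, f, heq, hnd⟩ := exists_conic_coefficients hP hgrad Φ
  let F : Cubic ℂ := ⟨0, c, f, b⟩
  have hF : ∀ z, F.toPoly.eval z = eval (Φ ![0, 1, z]) P := fun z => by
    rw [heq]
    simp [F, Cubic.toPoly]
    ring
  have hF0 : F.toPoly ≠ 0 := fun h0 => by
    have hc : c = 0 := by simpa [F] using congrArg (fun p => p.coeff 2) h0
    have hf : f = 0 := by simpa [F] using congrArg (fun p => p.coeff 1) h0
    have hb : b = 0 := by simpa [F] using congrArg (fun p => p.coeff 0) h0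
    subst hc hf hb
    by_cases hde : d = 0 ∧ e = 0
    · obtain ⟨rfl, rfl⟩ := hde
      exact one_ne_zero (hnd 0 1 0 (by simp) (by simp) (by simp)).2.1
    · have := hnd 0 e (-d) (by ring) (by ring) (by ring)
      exact hde ⟨neg_eq_zero.1 this.2.2, this.2.1⟩
  refine (Polynomial.finite_setOfPred_isRoot hF0).subset fun z hz => ?_
  simpa [Polynomial.IsRoot, hF] using hz

end quadric

/-- A ball in the complex plane stays path connected after removing a countable set. -/
theorem isPathConnected_ball_diff_countable (c : ℂ) {r : ℝ} (hr : 0 < r) {T : Set ℂ}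
    (hT : T.Countable) : IsPathConnected (Metric.ball c r \ T) := by
  let e := OpenPartialHomeomorph.univBall c r
  have hsrc : e.source = univ := OpenPartialHomeomorph.univBall_source c r
  have htgt : e.target = Metric.ball c r := OpenPartialHomeomorph.univBall_target c hr
  have hinj : Function.Injective e := by
    rw [← injOn_univ, ← hsrc]
    exact e.injOn
  have h1 : IsPathConnected (e ⁻¹' T)ᶜ :=
    (hT.preimage hinj).isPathConnected_compl_of_one_lt_rank (by simp)
  have hcont : Continuous e := by
    rw [← continuousOn_univ, ← hsrc]
    exact e.continuousOn
  have h2 := h1.image hcont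
  convert h2 using 1
  rw [← htgt, ← e.image_source_eq_target, hsrc]
  ext t
  constructor
  · rintro ⟨⟨s, -, rfl⟩, hs⟩
    exact ⟨s, hs, rfl⟩
  · rintro ⟨s, hs, rfl⟩
    exact ⟨⟨s, mem_univ _, rfl⟩, hs⟩

theorem exists_mem_diff_countable {A T : Set ℂ} (hA : IsOpen A) (hne : A.Nonempty)
    (hT : T.Countable) : ∃ a ∈ A, a ∉ T := by
  obtain ⟨a, ha, hT'⟩ := (hT.dense_compl ℝ).inter_open_nonempty A hA hne
  exact ⟨a, ha, hT'⟩

/-- A space mapping to the twice punctured plane, with a section outside a countable set, contains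
a free group of rank two in its fundamental group. -/
theorem exists_injective_freeGroup_of_section {W : Type*} [TopologicalSpace W] (L : W → ℂ)
    (hL : Continuous L) (h1 : ∀ w, L w ≠ 1) (h2 : ∀ w, L w ≠ -1) {T : Set ℂ} (hT : T.Countable)
    (g : ↥(Tᶜ) → W) (hg : Continuous g) (hLg : ∀ t, L (g t) = t) :
    ∃ (w : W) (f : FreeGroup (Fin 2) →* FundamentalGroup W w), Function.Injective f := by
  have ball_joined : ∀ (c : ℂ) (r : ℝ) (A : Set W), 0 < r →
      (∀ w, L w ∈ Metric.ball c r → w ∈ A) → ∀ s t : ↥(Tᶜ), s.1 ∈ Metric.ball c r →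
      t.1 ∈ Metric.ball c r → JoinedIn A (g s) (g t) := by
    intro c r A hr hA s t hs ht
    obtain ⟨γ, hγ⟩ := (isPathConnected_ball_diff_countable c hr hT).joinedIn s ⟨hs, s.2⟩ t ⟨ht, t.2⟩
    let γ' : Path s t := ⟨⟨fun u => ⟨γ u, (hγ u).2⟩, by fun_prop⟩, by simp, by simp⟩
    exact ⟨γ'.map hg, fun u => hA _ (by
      simp only [Path.map_coe, Function.comp_apply, hLg]
      exact (hγ u).1)⟩
  have pick : ∀ (c d : ℂ) (r s : ℝ) (a : ℂ), a ∈ Metric.ball c r → a ∈ Metric.ball d s →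
      ∃ t : ↥(Tᶜ), t.1 ∈ Metric.ball c r ∧ t.1 ∈ Metric.ball d s := by
    intro c d r s a hc hd
    obtain ⟨t, ht, htT⟩ := exists_mem_diff_countable
      (Metric.isOpen_ball.inter Metric.isOpen_ball) ⟨a, hc, hd⟩ hT
    exact ⟨⟨t, htT⟩, ht⟩
  let U : Set W := {w | ¬((L w).re = 1 ∧ (L w).im ≤ 0) ∧ ¬((L w).re = -1 ∧ (L w).im ≤ 0)}
  let V : Set W := {w | ¬((L w).re = 1 ∧ 0 ≤ (L w).im) ∧ ¬((L w).re = -1 ∧ 0 ≤ (L w).im)}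
  have hre : Continuous fun w => (L w).re := Complex.continuous_re.comp hL
  have him : Continuous fun w => (L w).im := Complex.continuous_im.comp hL
  have hU : IsOpen U := by
    refine IsOpen.inter ?_ ?_ <;> refine isOpen_compl_iff.2 (IsClosed.inter ?_ ?_)
    · exact isClosed_eq hre continuous_const
    · exact isClosed_le him continuous_const
    · exact isClosed_eq hre continuous_const
    · exact isClosed_le him continuous_const
  have hV : IsOpen V := by
    refine IsOpen.inter ?_ ?_ <;> refine isOpen_compl_iff.2 (IsClosed.inter ?_ ?_)
    · exact isClosed_eq hre continuous_const
    · exact isClosed_le continuous_const him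
    · exact isClosed_eq hre continuous_const
    · exact isClosed_le continuous_const him
  have hcov : U ∪ V = univ := by
    refine eq_univ_of_forall fun w => ?_
    have a1 : ¬ ((L w).re = 1 ∧ (L w).im = 0) := fun h => h1 w (Complex.ext h.1 h.2)
    have a2 : ¬ ((L w).re = -1 ∧ (L w).im = 0) := fun h =>
      h2 w (Complex.ext (by simpa using h.1) (by simpa using h.2))
    rcases lt_trichotomy (L w).im 0 with h | h | h
    · exact Or.inr ⟨fun h' => h'.2.not_gt h, fun h' => h'.2.not_gt h⟩
    · exact Or.inl ⟨fun h' => a1 ⟨h'.1, h⟩, fun h' => a2 ⟨h'.1, h⟩⟩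
    · exact Or.inl ⟨fun h' => h'.2.not_gt h, fun h' => h'.2.not_gt h⟩
  let τ : W → FreeGroup (Fin 2) := fun w =>
    if (L w).re < -1 then FreeGroup.of 0 else if (L w).re < 1 then 1 else FreeGroup.of 1
  have hτ : ∀ w ∈ U ∩ V, ∀ᶠ w' in nhds w, τ w' = τ w := by
    rintro w ⟨hwU, hwV⟩
    have b1 : (L w).re ≠ 1 := fun h => (le_total (L w).im 0).elim
      (fun h' => hwU.1 ⟨h, h'⟩) fun h' => hwV.1 ⟨h, h'⟩
    have b2 : (L w).re ≠ -1 := fun h => (le_total (L w).im 0).elim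
      (fun h' => hwU.2 ⟨h, h'⟩) fun h' => hwV.2 ⟨h, h'⟩
    have c1 : ∀ᶠ w' in nhds w, ((L w').re < 1 ↔ (L w).re < 1) := by
      rcases b1.lt_or_gt with h | h
      · filter_upwards [hre.continuousAt.eventually_lt continuousAt_const h] with w' h'
        exact iff_of_true h' h
      · filter_upwards [continuousAt_const.eventually_lt hre.continuousAt h] with w' h'
        exact iff_of_false h'.not_gt h.not_gt
    have c2 : ∀ᶠ w' in nhds w, ((L w').re < -1 ↔ (L w).re < -1) := by
      rcases b2.lt_or_gt with h | h
      · filter_upwards [hre.continuousAt.eventually_lt continuousAt_const h] with w' h'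
        exact iff_of_true h' h
      · filter_upwards [continuousAt_const.eventually_lt hre.continuousAt h] with w' h'
        exact iff_of_false h'.not_gt h.not_gt
    filter_upwards [c1, c2] with w' e1 e2
    simp only [τ, e1, e2]
  have key : ∀ w : W, ∀ (c : ℂ) (r : ℝ), L w ∈ Metric.ball c r →
      |(L w).re - c.re| < r ∧ |(L w).im - c.im| < r := fun w c r h => by
    rw [Metric.mem_ball, Complex.dist_eq] at h
    exact ⟨(Complex.abs_re_le_norm (L w - c)).trans_lt h,
      (Complex.abs_im_le_norm (L w - c)).trans_lt h⟩
  have mem : ∀ (c a : ℂ) (r : ℝ), 0 < r → (a.re - c.re) ^ 2 + (a.im - c.im) ^ 2 < r ^ 2 →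
      a ∈ Metric.ball c r := fun c a r hr h => by
    rw [Metric.mem_ball, Complex.dist_eq, Complex.norm_eq_sqrt_sq_add_sq, Real.sqrt_lt' hr]
    simpa using h
  have up : ∀ w, L w ∈ Metric.ball (⟨0, 6⟩ : ℂ) 6 → w ∈ U := fun w h => by
    have := abs_lt.1 (key w _ _ h).2
    have h' : 0 < (L w).im := by dsimp only at this; linarith
    exact ⟨fun h => h.2.not_gt h', fun h => h.2.not_gt h'⟩
  have down : ∀ w, L w ∈ Metric.ball (⟨0, -6⟩ : ℂ) 6 → w ∈ V := fun w h => by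
    have := abs_lt.1 (key w _ _ h).2
    have h' : (L w).im < 0 := by dsimp only at this; linarith
    exact ⟨fun h => h.2.not_gt h', fun h => h.2.not_gt h'⟩
  have strip : ∀ a ∈ ({-2, 0, 2} : Set ℝ), ∀ w, L w ∈ Metric.ball (⟨a, 0⟩ : ℂ) 0.9 → w ∈ U := by
    intro a ha w h
    have := abs_lt.1 (key w _ _ h).1
    dsimp only at this
    constructor <;> rintro ⟨h, -⟩ <;> rw [h] at this <;> rcases ha with rfl | rfl | rfl <;>
      norm_num at this
  obtain ⟨b, hb, hb'⟩ := pick ⟨0, 0⟩ ⟨0, -6⟩ 0.9 6 ⟨0, -0.5⟩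
    (mem _ _ _ (by norm_num) (by norm_num)) (mem _ _ _ (by norm_num) (by norm_num))
  obtain ⟨b₁, hb₁, hb₁'⟩ := pick ⟨0, 0⟩ ⟨0, 6⟩ 0.9 6 ⟨0, 0.5⟩
    (mem _ _ _ (by norm_num) (by norm_num)) (mem _ _ _ (by norm_num) (by norm_num))
  have side : ∀ a ∈ ({-2, 2} : Set ℝ), ∃ y : ↥(Tᶜ), y.1 ∈ Metric.ball (⟨a, 0⟩ : ℂ) 0.9 ∧
      JoinedIn U (g b) (g y) ∧ JoinedIn V (g b) (g y) := by
    intro a ha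
    have ha2 : a ^ 2 = 4 := by rcases ha with rfl | rfl <;> norm_num
    have ha' : a ∈ ({-2, 0, 2} : Set ℝ) := by rcases ha with rfl | rfl <;> simp
    obtain ⟨y, hy, hy'⟩ := pick ⟨a, 0⟩ ⟨0, -6⟩ 0.9 6 ⟨a, -0.5⟩
      (mem _ _ _ (by norm_num) (by norm_num)) (mem _ _ _ (by norm_num) (by norm_num [ha2]))
    obtain ⟨y₁, hy₁, hy₁'⟩ := pick ⟨a, 0⟩ ⟨0, 6⟩ 0.9 6 ⟨a, 0.5⟩
      (mem _ _ _ (by norm_num) (by norm_num)) (mem _ _ _ (by norm_num) (by norm_num [ha2]))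
    refine ⟨y, hy, ?_, ball_joined _ _ _ (by norm_num) down _ _ hb' hy'⟩
    exact ((ball_joined _ _ _ (by norm_num) (strip 0 (by simp)) _ _ hb hb₁).trans
      (ball_joined _ _ _ (by norm_num) up _ _ hb₁' hy₁')).trans
      (ball_joined _ _ _ (by norm_num) (strip a ha') _ _ hy₁ hy)
  obtain ⟨l, hl, lU, lV⟩ := side (-2) (by simp)
  obtain ⟨r, hr, rU, rV⟩ := side 2 (by simp)
  have re_lt : ∀ (a : ℝ) (t : ↥(Tᶜ)), t.1 ∈ Metric.ball (⟨a, 0⟩ : ℂ) 0.9 →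
      -0.9 < t.1.re - a ∧ t.1.re - a < 0.9 := fun a t h => by
    have := abs_lt.1 (key (g t) _ _ (by rwa [hLg])).1
    rwa [hLg] at this
  have hb0 := re_lt _ _ hb
  have hl0 := re_lt _ _ hl
  have hr0 := re_lt _ _ hr
  refine ⟨g b, exists_injective_freeGroup_fundamentalGroup hU hV hcov τ hτ (w₀ := g b) ?_
    ![g l, g r] ?_ ?_ ?_⟩
  · have e1 : ¬ b.1.re < -1 := by linarith
    have e2 : b.1.re < 1 := by linarith
    simp [τ, hLg, e1, e2]
  · intro i
    fin_cases i
    · have e1 : l.1.re < -1 := by linarith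
      simp [τ, hLg, e1]
    · have e1 : ¬ r.1.re < -1 := by linarith
      have e2 : ¬ r.1.re < 1 := by linarith
      simp [τ, hLg, e1, e2]
  · intro i
    fin_cases i
    · exact lU
    · exact rU
  · intro i
    fin_cases i
    · exact lV
    · exact rV

theorem mul_conj_add_mul_conj_ne_zero {a b : ℂ} (h : a ≠ 0 ∨ b ≠ 0) :
    a * starRingEnd ℂ a + b * starRingEnd ℂ b ≠ 0 := by
  rw [Complex.mul_conj, Complex.mul_conj]
  have ha := Complex.normSq_nonneg a
  have hb := Complex.normSq_nonneg b
  have h' : 0 < Complex.normSq a + Complex.normSq b := by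
    rcases h with h | h
    · have := Complex.normSq_pos.2 h
      linarith
    · have := Complex.normSq_pos.2 h
      linarith
  exact_mod_cast h'.ne'

/-- The affine quadric `y ^ 2 + x * z = 1`. -/
abbrev AffineQuadric : Type := {v : Fin 3 → ℂ // v 1 ^ 2 + v 0 * v 2 = 1}

theorem AffineQuadric.continuous_coord (i : Fin 3) : Continuous fun w : AffineQuadric => w.1 i :=
  (continuous_apply i).comp continuous_subtype_val

/-- The chart of the affine quadric `y ^ 2 + x * z = 1` given by the parameters
`(1 - y) / x = z / (1 + y)` and `x`. -/
def affineQuadricChart : {w : AffineQuadric | w.1 0 ≠ 0 ∨ 1 + w.1 1 ≠ 0} ≃ₜ ℂ × ℂ where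
  toFun w := (((1 - w.1.1 1) * starRingEnd ℂ (w.1.1 0) + w.1.1 2 * starRingEnd ℂ (1 + w.1.1 1)) /
    (w.1.1 0 * starRingEnd ℂ (w.1.1 0) + (1 + w.1.1 1) * starRingEnd ℂ (1 + w.1.1 1)), w.1.1 0)
  invFun p := ⟨⟨![p.2, 1 - p.1 * p.2, 2 * p.1 - p.1 ^ 2 * p.2], by simp; ring⟩, by
    by_cases h : p.2 = 0
    · right
      norm_num [h]
    · exact Or.inl h⟩
  left_inv := by
    rintro ⟨⟨v, hv⟩, hw⟩
    have hD := mul_conj_add_mul_conj_ne_zero hw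
    refine Subtype.ext (Subtype.ext ?_)
    simp only at hD ⊢
    set D := v 0 * starRingEnd ℂ (v 0) + (1 + v 1) * starRingEnd ℂ (1 + v 1) with hDdef
    set t := ((1 - v 1) * starRingEnd ℂ (v 0) + v 2 * starRingEnd ℂ (1 + v 1)) / D with ht
    have htD : t * D = (1 - v 1) * starRingEnd ℂ (v 0) + v 2 * starRingEnd ℂ (1 + v 1) :=
      div_mul_cancel₀ _ hD
    have h1 : t * v 0 = 1 - v 1 := by
      refine mul_right_cancel₀ hD ?_
      linear_combination v 0 * htD + starRingEnd ℂ (1 + v 1) * hv - (1 - v 1) * hDdef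
    have h2 : t * (1 + v 1) = v 2 := by
      refine mul_right_cancel₀ hD ?_
      linear_combination (1 + v 1) * htD - starRingEnd ℂ (v 0) * hv - v 2 * hDdef
    ext i
    fin_cases i
    · rfl
    · change 1 - t * v 0 = v 1
      linear_combination -h1
    · change 2 * t - t ^ 2 * v 0 = v 2
      linear_combination -t * h1 + h2
  right_inv := by
    rintro ⟨t, x⟩
    have hw : x ≠ 0 ∨ 2 - t * x ≠ 0 := by
      by_cases h : x = 0
      · right
        norm_num [h]
      · exact Or.inl h
    have hD := mul_conj_add_mul_conj_ne_zero hw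
    refine Prod.ext ?_ rfl
    simp only [Matrix.cons_val_zero, Matrix.cons_val_one, Matrix.cons_val]
    have e : 1 + (1 - t * x) = 2 - t * x := by ring
    rw [e, div_eq_iff hD]
    ring
  continuous_toFun := by
    have hc (i : Fin 3) : Continuous
        fun w : {w : AffineQuadric | w.1 0 ≠ 0 ∨ 1 + w.1 1 ≠ 0} => w.1.1 i :=
      (AffineQuadric.continuous_coord i).comp continuous_subtype_val
    have h0 := Complex.continuous_conj.comp (hc 0)
    have h1 := Complex.continuous_conj.comp ((continuous_const (y := (1 : ℂ))).add (hc 1))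
    exact (Continuous.div (((continuous_const.sub (hc 1)).mul h0).add ((hc 2).mul h1))
      (((hc 0).mul h0).add ((continuous_const.add (hc 1)).mul h1))
      fun w => mul_conj_add_mul_conj_ne_zero w.2).prodMk (hc 0)
  continuous_invFun := by
    refine Continuous.subtype_mk (Continuous.subtype_mk (continuous_pi fun i => ?_) _) _
    fin_cases i <;> simp <;> fun_prop

/-- The involution of the affine quadric exchanging `x` with `z` and `y` with `-y`. -/
def affineQuadricSwap : AffineQuadric ≃ₜ AffineQuadric where
  toFun w := ⟨![w.1 2, -w.1 1, w.1 0], by simpa [mul_comm] using w.2⟩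
  invFun w := ⟨![w.1 2, -w.1 1, w.1 0], by simpa [mul_comm] using w.2⟩
  left_inv w := Subtype.ext (by ext i; fin_cases i <;> simp)
  right_inv w := Subtype.ext (by ext i; fin_cases i <;> simp)
  continuous_toFun := by
    refine Continuous.subtype_mk (continuous_pi fun i => ?_) _
    fin_cases i
    · exact AffineQuadric.continuous_coord 2
    · exact (AffineQuadric.continuous_coord 1).neg
    · exact AffineQuadric.continuous_coord 0
  continuous_invFun := by
    refine Continuous.subtype_mk (continuous_pi fun i => ?_) _
    fin_cases i
    · exact AffineQuadric.continuous_coord 2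
    · exact (AffineQuadric.continuous_coord 1).neg
    · exact AffineQuadric.continuous_coord 0

instance simplyConnectedSpace_affineQuadric : SimplyConnectedSpace AffineQuadric := by
  let U : Set AffineQuadric := {w | w.1 0 ≠ 0 ∨ 1 + w.1 1 ≠ 0}
  have hU : IsOpen U :=
    (isOpen_ne_fun (AffineQuadric.continuous_coord 0) continuous_const).union
      (isOpen_ne_fun (continuous_const.add (AffineQuadric.continuous_coord 1)) continuous_const)
  have sU : IsSimplyConnected U := affineQuadricChart.toHomotopyEquiv.simplyConnectedSpace
  have swap_mem : ∀ p, affineQuadricSwap (affineQuadricChart.symm p).1 ∈ U ↔ p.1 ≠ 0 := by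
    rintro ⟨t, x⟩
    change 2 * t - t ^ 2 * x ≠ 0 ∨ 1 + -(1 - t * x) ≠ 0 ↔ t ≠ 0
    constructor
    · rintro h rfl
      simp at h
    · intro ht
      by_contra! h
      have h1 : t * x = 0 := by linear_combination h.2
      exact ht (by linear_combination (1 / 2) * h.1 + (1 / 2) * t * h1)
  have key : U ∩ affineQuadricSwap ⁻¹' U =
      (fun p => (affineQuadricChart.symm p).1) '' ({0}ᶜ ×ˢ univ) := by
    ext w
    constructor
    · rintro ⟨h1, h2⟩
      refine ⟨affineQuadricChart ⟨w, h1⟩, ⟨(swap_mem _).1 ?_, mem_univ _⟩, by simp⟩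
      simpa using h2
    · rintro ⟨p, ⟨hp, -⟩, rfl⟩
      exact ⟨(affineQuadricChart.symm p).2, (swap_mem p).2 hp⟩
  refine simplyConnectedSpace_of_union hU (hU.preimage affineQuadricSwap.continuous) sU
    ((affineQuadricSwap.isSimplyConnected_preimage).2 sU) ?_ ?_
  · rw [key]
    have h1 : IsPathConnected ({0}ᶜ : Set ℂ) :=
      isPathConnected_compl_singleton_of_one_lt_rank (by simp) 0
    refine (h1.prod isPathConnected_univ).image ?_
    exact continuous_subtype_val.comp affineQuadricChart.symm.continuous
  · refine eq_univ_of_forall fun w => ?_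
    by_cases h : 1 + w.1 1 = 0
    · refine Or.inr (Or.inr ?_)
      change 1 + -w.1 1 ≠ 0
      have e : w.1 1 = -1 := by linear_combination h
      norm_num [e]
    · exact Or.inl (Or.inr h)

/-- The complement of a smooth conic has abelian fundamental group. -/
theorem mul_comm_fundamentalGroup_compl_conic {P : MvPolynomial (Fin 3) ℂ}
    (hP : P.IsHomogeneous 2) (hgrad : ∀ v : Fin 3 → ℂ, v ≠ 0 → gradP P v ≠ 0)
    (x : ↥((zeroLocusP2 P)ᶜ)) (a b : FundamentalGroup ↥((zeroLocusP2 P)ᶜ) x) : a * b = b * a := by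
  obtain ⟨p, hp, hpP⟩ := exists_conic_point hP
  obtain ⟨Φ, hΦ, -⟩ := exists_conic_coordinates hP hgrad hp hpP
  have hne : ∀ v, eval v P = 1 → v ≠ 0 := by
    rintro v hv rfl
    have := hP.eval_smul_two 0 0
    rw [smul_zero, hv] at this
    norm_num at this
  let e : AffineQuadric ≃ₜ unitLevel (fun v => eval v P) (zeroLocusP2 P) :=
    Φ.toContinuousLinearEquiv.toHomeomorph.subtype fun v => by
      change _ ↔ eval (Φ v) P = 1 ∧ ∃ h : Φ v ≠ 0, _
      rw [hΦ]
      refine ⟨fun h => ?_, fun h => h.1⟩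
      have h1 : eval (Φ v) P = 1 := by rw [hΦ, h]
      exact ⟨h, hne _ h1, fun h' =>
        one_ne_zero (h1.symm.trans ((mk_mem_zeroLocusP2 hP (hne _ h1)).1 h'))⟩
  have : SimplyConnectedSpace (unitLevel (fun v => eval v P) (zeroLocusP2 P)) :=
    e.symm.toHomotopyEquiv.simplyConnectedSpace
  refine mul_comm_fundamentalGroup_of_unitLevel (q := fun v => eval v P)
    (MvPolynomial.continuous_eval P) hP.eval_smul_two (fun v hv h h' => h ?_) x a b
  exact (mk_mem_zeroLocusP2 hP hv).2 h'

theorem finite_zeros_on_line (P : MvPolynomial (Fin 3) ℂ) {v : Fin 3 → ℂ} (hv : eval v P ≠ 0)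
    (d : Fin 3 → ℂ) : {t : ℂ | eval (v + t • d) P = 0}.Finite := by
  let F : Polynomial ℂ :=
    aeval (fun i => Polynomial.C (v i) + Polynomial.X * Polynomial.C (d i)) P
  have hF : ∀ t, F.eval t = eval (v + t • d) P := fun t => by
    clear hv
    simp only [F]
    induction P using MvPolynomial.induction_on with
    | C a => simp
    | add p q hp hq => simp_all
    | mul_X p i hp =>
      simp only [map_mul, aeval_X, Polynomial.eval_mul, hp]
      simp [mul_comm t]
  have hF0 : F ≠ 0 := fun h => hv (by simpa [h] using (hF 0).symm)
  refine (Polynomial.finite_setOfPred_isRoot hF0).subset fun z hz => ?_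
  simpa [Polynomial.IsRoot, hF] using hz

/-- The complement of finitely many conics is path connected. -/
theorem pathConnectedSpace_compl_conics {ι : Type*} [Finite ι] [Nonempty ι]
    {P : ι → MvPolynomial (Fin 3) ℂ} (hP : ∀ i, (P i).IsHomogeneous 2)
    (x₀ : ↥((⋃ i, zeroLocusP2 (P i))ᶜ)) :
    PathConnectedSpace ↥((⋃ i, zeroLocusP2 (P i))ᶜ) := by
  refine ⟨⟨x₀⟩, ?_⟩
  rintro ⟨x, hx⟩ ⟨y, hy⟩
  induction x using Projectivization.ind with
  | h v hv =>
  induction y using Projectivization.ind with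
  | h w hw =>
  have hmem : ∀ (u : Fin 3 → ℂ) (hu : u ≠ 0),
      Projectivization.mk ℂ u hu ∈ (⋃ i, zeroLocusP2 (P i))ᶜ ↔ ∀ i, eval u (P i) ≠ 0 := by
    intro u hu
    simp [mk_mem_zeroLocusP2 (hP _) hu]
  have hne : ∀ u : Fin 3 → ℂ, (∀ i, eval u (P i) ≠ 0) → u ≠ 0 := by
    rintro u hu rfl
    obtain ⟨i⟩ := ‹Nonempty ι›
    exact hu i (by simpa using (hP i).eval_smul_two 0 0)
  let T : Set ℂ := ⋃ i, {t : ℂ | eval (v + t • (w - v)) (P i) = 0}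
  have hT : T.Finite := finite_iUnion fun i =>
    finite_zeros_on_line (P i) ((hmem v hv).1 hx i) (w - v)
  have hT' : ∀ t ∉ T, ∀ i, eval (v + t • (w - v)) (P i) ≠ 0 := fun t ht i h =>
    ht (mem_iUnion.2 ⟨i, h⟩)
  have h0 : (0 : ℂ) ∉ T := by simpa [T] using (hmem v hv).1 hx
  have h1 : (1 : ℂ) ∉ T := by simpa [T] using (hmem w hw).1 hy
  obtain ⟨γ, hγ⟩ := (hT.countable.isPathConnected_compl_of_one_lt_rank (by simp)).joinedIn 0 h0 1 h1
  have hγ' : ∀ s, v + γ s • (w - v) ≠ 0 := fun s => hne _ (hT' _ (hγ s))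
  refine ⟨⟨⟨fun s => ⟨Projectivization.mk ℂ (v + γ s • (w - v)) (hγ' s),
    (hmem _ _).2 (hT' _ (hγ s))⟩, ?_⟩, ?_, ?_⟩⟩
  · refine Continuous.subtype_mk ?_ _
    exact continuous_projectivization_mk.comp
      (Continuous.subtype_mk (f := fun s => v + γ s • (w - v)) (by fun_prop) hγ')
  · simp
  · simp

/-- The complement of finitely many smooth conics, two of which meet in a single point, has big
fundamental group. -/
theorem isBig_fundamentalGroup_compl_conics {ι : Type*} [Finite ι]
    {P : ι → MvPolynomial (Fin 3) ℂ} (hP : ∀ i, (P i).IsHomogeneous 2)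
    (hgrad : ∀ i, ∀ v : Fin 3 → ℂ, v ≠ 0 → gradP (P i) v ≠ 0) (i₀ i₁ : ι)
    {p : P2} (hp : zeroLocusP2 (P i₀) ∩ zeroLocusP2 (P i₁) = {p})
    (x : ↥((⋃ i, zeroLocusP2 (P i))ᶜ)) :
    IsBig (FundamentalGroup ↥((⋃ i, zeroLocusP2 (P i))ᶜ) x) := by
  have : Nonempty ι := ⟨i₀⟩
  have := pathConnectedSpace_compl_conics hP x
  induction p using Projectivization.ind with
  | h p hp0 =>
  have hmem : (Projectivization.mk ℂ p hp0 : P2) ∈ zeroLocusP2 (P i₀) ∩ zeroLocusP2 (P i₁) := by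
    rw [hp]
    rfl
  obtain ⟨Φ, hΦ, hΦp⟩ := exists_conic_coordinates (hP i₀) (hgrad i₀) hp0
    ((mk_mem_zeroLocusP2 (hP i₀) hp0).1 hmem.1)
  obtain ⟨b, c, hb, hc, hbc⟩ := exists_tangent_conic_equation (hP i₁) (hgrad i₁) Φ
    (by rw [hΦp, ← mk_mem_zeroLocusP2 (hP i₁) hp0]; exact hmem.2) (fun y hy => by
      have hv : Φ ![-y ^ 2, y, 1] ≠ 0 := by
        rw [Ne, Φ.map_eq_zero_iff]
        exact fun h => one_ne_zero (congrFun h 2)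
      have h1 : (Projectivization.mk ℂ _ hv : P2) ∈
          zeroLocusP2 (P i₀) ∩ zeroLocusP2 (P i₁) :=
        ⟨(mk_mem_zeroLocusP2 (hP i₀) hv).2 (by rw [hΦ]; simp),
          (mk_mem_zeroLocusP2 (hP i₁) hv).2 hy⟩
      rw [hp] at h1
      obtain ⟨a, ha⟩ := (Projectivization.mk_eq_mk_iff' ..).1 (mem_singleton_iff.1 h1)
      rw [← hΦp, ← map_smul] at ha
      simpa using congrFun (Φ.injective ha) 2)
  obtain ⟨κ, hκ⟩ := IsAlgClosed.exists_pow_nat_eq (-c / b) two_pos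
  have hκ0 : κ ≠ 0 := by
    rintro rfl
    simp [hb, hc, eq_comm] at hκ
  have hκ' : b * κ ^ 2 = -c := by
    rw [hκ]
    field_simp
  let S : Set P2 := ⋃ i, zeroLocusP2 (P i)
  let q : (Fin 3 → ℂ) → ℂ := fun v => eval v (P i₀)
  have hS : ∀ (v : Fin 3 → ℂ) (h : v ≠ 0), Projectivization.mk ℂ v h ∉ S ↔
      ∀ i, eval v (P i) ≠ 0 := fun v hv => by
    simp [S, mk_mem_zeroLocusP2 (hP _) hv]
  let L : unitLevel q S → ℂ := fun w => κ * Φ.symm w.1 2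
  have hL : Continuous L := by
    have h1 : Continuous Φ.symm := Φ.symm.toLinearMap.continuous_of_finiteDimensional
    exact continuous_const.mul ((continuous_apply 2).comp (h1.comp continuous_subtype_val))
  have hL1 : ∀ w, L w ^ 2 ≠ 1 := by
    rintro ⟨v, hv1, hv0, hvS⟩ h
    refine (hS v hv0).1 hvS i₁ ?_
    obtain ⟨u, rfl⟩ := Φ.surjective v
    have hu : ![u 0, u 1, u 2] = u := by
      ext i
      fin_cases i <;> rfl
    have h2 := hbc (u 0) (u 1) (u 2)
    have h3 : u 1 ^ 2 + u 0 * u 2 = 1 := by rw [← hΦ]; exact hv1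
    have h4 : (κ * u 2) ^ 2 = 1 := by simpa [L] using h
    rw [hu, h3] at h2
    rw [h2]
    linear_combination b * -h4 + u 2 ^ 2 * hκ'
  let T : Set ℂ := ⋃ i, {t : ℂ | eval (Φ ![0, 1, κ⁻¹ * t]) (P i) = 0}
  have hT : T.Finite := finite_iUnion fun i =>
    (finite_line_inter_conic (hP i) (hgrad i) Φ).preimage
      (mul_right_injective₀ (inv_ne_zero hκ0)).injOn
  have hg : ∀ t : ↥(Tᶜ), q (Φ ![0, 1, κ⁻¹ * t]) = 1 ∧ ∃ h : Φ ![0, 1, κ⁻¹ * t] ≠ 0,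
      Projectivization.mk ℂ _ h ∉ S := fun t => by
    refine ⟨by simp [q, hΦ], ?_, (hS _ _).2 fun i h => t.2 (mem_iUnion.2 ⟨i, h⟩)⟩
    rw [Ne, Φ.map_eq_zero_iff]
    exact fun h => one_ne_zero (congrFun h 1)
  obtain ⟨w, hw⟩ := exists_injective_freeGroup_of_section L hL (fun w h => hL1 w (by simp [h]))
    (fun w h => hL1 w (by simp [h])) hT.countable (fun t => ⟨Φ ![0, 1, κ⁻¹ * t], hg t⟩) (by
      refine Continuous.subtype_mk ?_ _
      refine Φ.toLinearMap.continuous_of_finiteDimensional.comp (continuous_pi fun i => ?_)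
      fin_cases i
      · exact continuous_const
      · exact continuous_const
      · exact continuous_const.mul continuous_subtype_val)
    (fun t => by simp [L, hκ0])
  exact isBig_fundamentalGroup_of_unitLevel (q := q) (S := S)
    (MvPolynomial.continuous_eval (P i₀))
    (hP i₀).eval_smul_two (fun v hv h => (hS v hv).1 h i₀) w hw x

end

/-- **Corollary.** For the arrangement `𝒞ₙ`, the fundamental group of the complement is
abelian for `n = 1` and big for `n ≥ 2`. -/
theorem fundamental_group_Cn_abelian_or_big (n : ℕ) (hn : 0 < n) (Q : Fin n → Set P2)
    (hconic : ∀ i, IsSmoothConic (Q i))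
    (hdist : ∀ i j : Fin n, i ≠ j → Q i ≠ Q j)
    (htan : ∀ i : Fin n, i ≠ ⟨0, hn⟩ → ∃ p : P2, Q ⟨0, hn⟩ ∩ Q i = {p})
    (htrans : ∀ i j : Fin n, i ≠ ⟨0, hn⟩ → j ≠ ⟨0, hn⟩ → i ≠ j → (Q i ∩ Q j).ncard = 4)
    (hthree : ∀ (x : P2) (i j k : Fin n), i ≠ j → i ≠ k → j ≠ k →
      ¬(x ∈ Q i ∧ x ∈ Q j ∧ x ∈ Q k))
    (x : ↥(⋃ i, Q i)ᶜ) :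
    (n = 1 → ∀ a b : FundamentalGroup (↥(⋃ i, Q i)ᶜ) x, a * b = b * a) ∧
    (2 ≤ n → IsBig (FundamentalGroup (↥(⋃ i, Q i)ᶜ) x)) := by
  choose P hP hgrad hQ using hconic
  obtain rfl : Q = fun i => zeroLocusP2 (P i) := funext hQ
  refine ⟨?_, fun h2 => ?_⟩
  · rintro rfl
    have key : ∀ (S : Set P2), S = zeroLocusP2 (P 0) → ∀ (y : ↥Sᶜ)
        (a b : FundamentalGroup ↥Sᶜ y), a * b = b * a := by
      rintro _ rfl
      exact mul_comm_fundamentalGroup_compl_conic (hP 0) (hgrad 0)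
    exact key _ (ciSup_unique) x
  · obtain ⟨p, hp⟩ := htan ⟨1, h2⟩ (by simp)
    exact isBig_fundamentalGroup_compl_conics hP hgrad ⟨0, hn⟩ ⟨1, h2⟩ hp x
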